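/- Fix m ∈ {1,…,K−1} and α, β ∈ (0,1). If the threshold of the gap rule is chosen as c = |log(α∧β)| + log(m(K−m)), then for every A ⊆ [K] with |A| = m one has P_A(d_G ≠ A) ≤ α∧β; consequently the gap rule belongs to Δ_{α,β}(P_m), i.e. its familywise type I and type II error probabilities are at most α and β respectively for every A ∈ P_m. -/

import Mathlib

open MeasureTheory ProbabilityTheory Filter Set
open scoped ENNReal NNReal Topology Classical

noncomputable section

namespace SeqMT

variable {Ω : Type*}

/-- The `m`-th largest value (1-indexed, for `1 ≤ m ≤ K`) among `v 0, …, v (K-1)`. -/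
noncomputable def orderStat {K : ℕ} (v : Fin K → ℝ) (m : ℕ) : ℝ :=
  ((Finset.univ.val.map v).sort (· ≤ ·)).getD (K - m) 0

/-- The number of strictly positive entries of `v`. -/
noncomputable def posCount {K : ℕ} (v : Fin K → ℝ) : ℕ :=
  (Finset.univ.filter fun k => 0 < v k).card

/-- The rank (0-indexed) of stream `k`, ordering by value (descending) with ties broken
by stream index: `rankOf v k = r` means `k = i_{r+1}`. -/
noncomputable def rankOf {K : ℕ} (v : Fin K → ℝ) (k : Fin K) : ℕ :=
  (Finset.univ.filter fun j => v k < v j ∨ (v j = v k ∧ j < k)).card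

/-- The set `{i_1, …, i_m}` of the `m` streams with the largest values. -/
noncomputable def topSet {K : ℕ} (v : Fin K → ℝ) (m : ℕ) : Finset (Fin K) :=
  Finset.univ.filter fun k => rankOf v k < m

/-- First time `n ≥ 1` at which `Q n` holds (`⊤` if it never does). -/
noncomputable def stopTime (Q : ℕ → Ω → Prop) (ω : Ω) : ℕ∞ :=
  sInf {n : ℕ∞ | ∃ m : ℕ, n = (m : ℕ∞) ∧ 1 ≤ m ∧ Q m ω}

/-- The log-likelihood ratio process `λ^{A,C}` of `P_A` versus `P_C`. -/
def llrAC {K : ℕ} (lam : Fin K → ℕ → Ω → ℝ) (A C : Finset (Fin K)) (n : ℕ) (ω : Ω) : ℝ :=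
  ∑ k ∈ A \ C, lam k n ω - ∑ k ∈ C \ A, lam k n ω

/-- The gap rule stopping time `T_G`. -/
noncomputable def gapTime {K : ℕ} (lam : Fin K → ℕ → Ω → ℝ) (m : ℕ) (c : ℝ) : Ω → ℕ∞ :=
  stopTime fun n ω =>
    c ≤ orderStat (fun k => lam k n ω) m - orderStat (fun k => lam k n ω) (m + 1)

/-- The gap rule decision `d_G = {i_1(T_G), …, i_m(T_G)}`. -/
noncomputable def gapDecision {K : ℕ} (lam : Fin K → ℕ → Ω → ℝ) (m : ℕ) (c : ℝ)
    (ω : Ω) : Finset (Fin K) :=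
  topSet (fun k => lam k (gapTime lam m c ω).toNat ω) m

/-- `τ₁` (with the convention `λ^{(0)} = -∞`, so `τ₁ = ∞` when `ℓ = 0`). -/
noncomputable def tau1 {K : ℕ} (lam : Fin K → ℕ → Ω → ℝ) (ℓ : ℕ) (a c : ℝ) : Ω → ℕ∞ :=
  stopTime fun n ω => 1 ≤ ℓ ∧ orderStat (fun k => lam k n ω) (ℓ + 1) ≤ -a ∧
    c ≤ orderStat (fun k => lam k n ω) ℓ - orderStat (fun k => lam k n ω) (ℓ + 1)

/-- `τ₂`. -/
noncomputable def tau2 {K : ℕ} (lam : Fin K → ℕ → Ω → ℝ) (ℓ u : ℕ) (a b : ℝ) : Ω → ℕ∞ :=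
  stopTime fun n ω => ℓ ≤ posCount (fun k => lam k n ω) ∧ posCount (fun k => lam k n ω) ≤ u ∧
    ∀ k : Fin K, lam k n ω ∉ Set.Ioo (-a) b

/-- `τ₃` (with the convention `λ^{(K+1)} = ∞`, so `τ₃ = ∞` when `u = K`). -/
noncomputable def tau3 {K : ℕ} (lam : Fin K → ℕ → Ω → ℝ) (u : ℕ) (b d : ℝ) : Ω → ℕ∞ :=
  stopTime fun n ω => u < K ∧ b ≤ orderStat (fun k => lam k n ω) u ∧
    d ≤ orderStat (fun k => lam k n ω) u - orderStat (fun k => lam k n ω) (u + 1)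

/-- The gap-intersection stopping time `T_GI = min{τ₁, τ₂, τ₃}`. -/
noncomputable def giTime {K : ℕ} (lam : Fin K → ℕ → Ω → ℝ) (ℓ u : ℕ) (a b c d : ℝ) :
    Ω → ℕ∞ := fun ω =>
  min (tau1 lam ℓ a c ω) (min (tau2 lam ℓ u a b ω) (tau3 lam u b d ω))

/-- The gap-intersection decision `d_GI = {i_1(T_GI), …, i_{p'}(T_GI)}`,
`p' = min(max(p(T_GI), ℓ), u)`. -/
noncomputable def giDecision {K : ℕ} (lam : Fin K → ℕ → Ω → ℝ) (ℓ u : ℕ) (a b c d : ℝ)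
    (ω : Ω) : Finset (Fin K) :=
  topSet (fun k => lam k (giTime lam ℓ u a b c d ω).toNat ω)
    (min (max (posCount (fun k => lam k (giTime lam ℓ u a b c d ω).toNat ω)) ℓ) u)

/-- The intersection rule stopping time `T_I`. -/
noncomputable def interTime {K : ℕ} (lam : Fin K → ℕ → Ω → ℝ) (a b : ℝ) : Ω → ℕ∞ :=
  stopTime fun n ω => ∀ k : Fin K, lam k n ω ∉ Set.Ioo (-a) b

/-- The intersection rule decision `d_I`: streams with positive LLR at `T_I`. -/
noncomputable def interDecision {K : ℕ} (lam : Fin K → ℕ → Ω → ℝ) (a b : ℝ)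
    (ω : Ω) : Finset (Fin K) :=
  Finset.univ.filter fun k => 0 < lam k (interTime lam a b ω).toNat ω

/-- `φ(x,y) = x log(x/(1-y)) + (1-x) log((1-x)/y)`. -/
noncomputable def phi (x y : ℝ) : ℝ :=
  x * Real.log (x / (1 - y)) + (1 - x) * Real.log ((1 - x) / y)

/-- `γ_{A,C}(α,β)`. -/
noncomputable def gammaAC {K : ℕ} (A C : Finset (Fin K)) (α β : ℝ) : ℝ :=
  if (C \ A).Nonempty ∧ A \ C = ∅ then phi α β
  else if C \ A = ∅ ∧ (A \ C).Nonempty then phi β α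
  else max (phi α β) (phi β α)

/-- `min_{k ∈ S} D k`, as an extended nonnegative real (so `= ∞` when `S = ∅`). -/
noncomputable def eta {K : ℕ} (S : Finset (Fin K)) (D : Fin K → ℝ) : ℝ≥0∞ :=
  S.inf fun k => ENNReal.ofReal (D k)

/-- `T` is a stopping time of the filtration `F`. -/
def IsST (F : ℕ → MeasurableSpace Ω) (T : Ω → ℕ∞) : Prop :=
  ∀ n : ℕ, MeasurableSet[F n] {ω | T ω ≤ (n : ℕ∞)}

/-- `d` is an `F_T`-measurable decision. -/
def IsDecision {K : ℕ} (F : ℕ → MeasurableSpace Ω) (T : Ω → ℕ∞)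
    (d : Ω → Finset (Fin K)) : Prop :=
  ∀ (n : ℕ) (B : Finset (Fin K)), MeasurableSet[F n] {ω | d ω = B ∧ T ω = (n : ℕ∞)}

/-- `(T,d) ∈ Δ_{α,β}(Pcl)`: both familywise error probabilities are controlled for all `A ∈ Pcl`. -/
def InDelta {K : ℕ} [MeasurableSpace Ω] (P : Finset (Fin K) → Measure Ω) (Pcl : Set (Finset (Fin K)))
    (α β : ℝ) (T : Ω → ℕ∞) (d : Ω → Finset (Fin K)) : Prop :=
  ∀ A ∈ Pcl, (P A {ω | ¬ d ω ⊆ A}).toReal ≤ α ∧ (P A {ω | ¬ A ⊆ d ω}).toReal ≤ β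

/-- `inf_{(T,d) ∈ Δ_{α,β}(Pcl)} E_A[T]`. -/
noncomputable def optESS {K : ℕ} [MeasurableSpace Ω] (P : Finset (Fin K) → Measure Ω)
    (F : ℕ → MeasurableSpace Ω) (Pcl : Set (Finset (Fin K))) (α β : ℝ)
    (A : Finset (Fin K)) : ℝ≥0∞ :=
  ⨅ (T : Ω → ℕ∞) (d : Ω → Finset (Fin K))
    (_ : IsST F T ∧ IsDecision F T d ∧ InDelta P Pcl α β T d),
      ∫⁻ ω, (T ω : ℝ≥0∞) ∂ P A

end SeqMT

namespace SeqMT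


lemma countP_sort {K : ℕ} (v : Fin K → ℝ) (p : ℝ → Prop) [DecidablePred p] :
    ((Finset.univ.val.map v).sort (· ≤ ·)).countP (fun x => decide (p x))
      = (Finset.univ.filter fun k => p (v k)).card := by
  have h1 : ((((Finset.univ.val.map v).sort (· ≤ ·)) : List ℝ) : Multiset ℝ).countP p
      = (Finset.univ.filter fun k => p (v k)).card := by
    rw [Multiset.sort_eq, Multiset.countP_map]
    rfl
  rw [← h1]
  rfl

lemma length_sort' {K : ℕ} (v : Fin K → ℝ) :
    ((Finset.univ.val.map v).sort (· ≤ ·)).length = K := by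
  simp

lemma countP_le_of_prefix (l : List ℝ) (p : ℝ → Bool) (r : ℕ)
    (h : ∀ (i : ℕ) (hi : i < l.length), i < r → p l[i] = false) :
    l.countP p ≤ l.length - r := by
  have h0 : (l.take r).countP p = 0 := by
    rw [List.countP_eq_zero]
    intro a ha
    obtain ⟨i, hi, rfl⟩ := List.getElem_of_mem ha
    rw [List.length_take] at hi
    rw [List.getElem_take, h i (by omega) (by omega)]
    simp
  have h1 : (l.drop r).countP p ≤ (l.drop r).length := List.countP_le_length
  have h2 : l.countP p = (l.take r).countP p + (l.drop r).countP p := by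
    rw [← List.countP_append, List.take_append_drop]
  rw [List.length_drop] at h1
  omega

lemma countP_le_of_suffix (l : List ℝ) (p : ℝ → Bool) (r : ℕ)
    (h : ∀ (i : ℕ) (hi : i < l.length), r ≤ i → p l[i] = false) :
    l.countP p ≤ r := by
  have h0 : (l.drop r).countP p = 0 := by
    rw [List.countP_eq_zero]
    intro a ha
    obtain ⟨i, hi, rfl⟩ := List.getElem_of_mem ha
    rw [List.length_drop] at hi
    rw [List.getElem_drop, h (r + i) (by omega) (by omega)]
    simp
  have h1 : (l.take r).countP p ≤ (l.take r).length := List.countP_le_length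
  have h2 : l.countP p = (l.take r).countP p + (l.drop r).countP p := by
    rw [← List.countP_append, List.take_append_drop]
  rw [List.length_take] at h1
  omega

lemma sort_mono {K : ℕ} (v : Fin K → ℝ) (i j : ℕ) (hij : i ≤ j)
    (hj : j < ((Finset.univ.val.map v).sort (· ≤ ·)).length) :
    ((Finset.univ.val.map v).sort (· ≤ ·))[i]'(lt_of_le_of_lt hij hj)
      ≤ ((Finset.univ.val.map v).sort (· ≤ ·))[j] := by
  rcases hij.eq_or_lt with h | h
  · subst h; exact le_rfl
  · exact List.pairwise_iff_getElem.1 (Multiset.pairwise_sort _ _) i j _ hj h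

lemma orderStat_eq {K : ℕ} (v : Fin K → ℝ) (m : ℕ) (h1 : 1 ≤ m) (h2 : m ≤ K) :
    orderStat v m = ((Finset.univ.val.map v).sort (· ≤ ·))[K - m]'(by
      rw [length_sort']; omega) := by
  unfold orderStat
  rw [List.getD_eq_getElem]

lemma le_orderStat {K : ℕ} (v : Fin K → ℝ) (m : ℕ) (h1 : 1 ≤ m) (h2 : m ≤ K) (x : ℝ)
    (h : m ≤ (Finset.univ.filter fun k => x ≤ v k).card) : x ≤ orderStat v m := by
  by_contra hx
  rw [orderStat_eq v m h1 h2] at hx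
  push Not at hx
  have := countP_le_of_prefix ((Finset.univ.val.map v).sort (· ≤ ·))
    (fun y => decide (x ≤ y)) (K - m + 1) (by
      intro i hi hir
      have := sort_mono v i (K - m) (by omega) (by rw [length_sort']; omega)
      simp only [decide_eq_false_iff_not, not_le]
      linarith)
  rw [countP_sort v (fun y => x ≤ y), length_sort'] at this
  omega

lemma orderStat_le {K : ℕ} (v : Fin K → ℝ) (m : ℕ) (h1 : 1 ≤ m) (h2 : m ≤ K) (x : ℝ)
    (h : K - m + 1 ≤ (Finset.univ.filter fun k => v k ≤ x).card) : orderStat v m ≤ x := by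
  by_contra hx
  rw [orderStat_eq v m h1 h2] at hx
  push Not at hx
  have := countP_le_of_suffix ((Finset.univ.val.map v).sort (· ≤ ·))
    (fun y => decide (y ≤ x)) (K - m) (by
      intro i hi hir
      have := sort_mono v (K - m) i (by omega) hi
      simp only [decide_eq_false_iff_not, not_le]
      linarith)
  rw [countP_sort v (fun y => y ≤ x)] at this
  omega

lemma dichotomy {K : ℕ} (v : Fin K → ℝ) (m : ℕ) (h1 : 1 ≤ m) (h2 : m + 1 ≤ K) (k : Fin K) :
    orderStat v m ≤ v k ∨ v k ≤ orderStat v (m + 1) := by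
  rw [orderStat_eq v m h1 (by omega), orderStat_eq v (m + 1) (by omega) h2]
  have hk : v k ∈ (Finset.univ.val.map v).sort (· ≤ ·) := by
    rw [Multiset.mem_sort]
    exact Multiset.mem_map_of_mem v (Finset.mem_univ k)
  obtain ⟨i, hi, hik⟩ := List.getElem_of_mem hk
  rw [← hik]
  by_cases h : K - m ≤ i
  · exact Or.inl (sort_mono v _ _ h hi)
  · exact Or.inr (sort_mono v _ _ (by omega) (by rw [length_sort']; omega))

lemma card_ge {K : ℕ} (v : Fin K → ℝ) (m : ℕ) (h1 : 1 ≤ m) (h2 : m + 1 ≤ K)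
    (hlt : orderStat v (m + 1) < orderStat v m) :
    (Finset.univ.filter fun k => orderStat v m ≤ v k).card = m := by
  apply le_antisymm
  · have := countP_le_of_prefix ((Finset.univ.val.map v).sort (· ≤ ·))
      (fun y => decide (orderStat v m ≤ y)) (K - m) (by
        intro i hi hir
        have := sort_mono v i (K - (m + 1)) (by omega) (by rw [length_sort']; omega)
        rw [← orderStat_eq v (m + 1) (by omega) h2] at this
        simp only [decide_eq_false_iff_not, not_le]
        linarith)
    rw [countP_sort v (fun y => orderStat v m ≤ y), length_sort'] at this
    omega
  · have := countP_le_of_suffix ((Finset.univ.val.map v).sort (· ≤ ·))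
      (fun y => decide (¬ orderStat v m ≤ y)) (K - m) (by
        intro i hi hir
        have := sort_mono v (K - m) i (by omega) hi
        rw [← orderStat_eq v m h1 (by omega)] at this
        simpa using this)
    rw [countP_sort v (fun y => ¬ orderStat v m ≤ y)] at this
    have h3 := Finset.card_filter_add_card_filter_not (s := (Finset.univ : Finset (Fin K)))
      (fun k => orderStat v m ≤ v k)
    rw [Finset.card_univ, Fintype.card_fin] at h3
    omega

lemma topSet_eq {K : ℕ} (v : Fin K → ℝ) (m : ℕ) (h1 : 1 ≤ m) (h2 : m + 1 ≤ K)
    (hlt : orderStat v (m + 1) < orderStat v m) :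
    topSet v m = Finset.univ.filter fun k => orderStat v m ≤ v k := by
  have hc := card_ge v m h1 h2 hlt
  ext k
  simp only [topSet, Finset.mem_filter, Finset.mem_univ, true_and]
  constructor
  · intro hr
    rcases dichotomy v m h1 h2 k with h | h
    · exact h
    · exfalso
      have : m ≤ rankOf v k := by
        rw [← hc]
        unfold rankOf
        apply Finset.card_le_card
        intro j hj
        simp only [Finset.mem_filter, Finset.mem_univ, true_and] at hj ⊢
        left
        linarith
      omega
  · intro hk
    rw [← hc]
    unfold rankOf
    apply Finset.card_lt_card
    rw [Finset.ssubset_iff_of_subset]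
    · refine ⟨k, by simpa using hk, by simp⟩
    · intro j hj
      simp only [Finset.mem_filter, Finset.mem_univ, true_and] at hj ⊢
      rcases hj with h | h
      · linarith
      · linarith [h.1]

lemma exists_pair {K : ℕ} (v : Fin K → ℝ) (m : ℕ) (h1 : 1 ≤ m) (h2 : m + 1 ≤ K) (c : ℝ)
    (hc : 0 < c) (hgap : c ≤ orderStat v m - orderStat v (m + 1))
    (A : Finset (Fin K)) (hA : A.card = m) (hne : topSet v m ≠ A) :
    ∃ i ∈ A, ∃ j ∈ Aᶜ, c ≤ v j - v i := by
  have hlt : orderStat v (m + 1) < orderStat v m := by linarith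
  have ht := topSet_eq v m h1 h2 hlt
  have hcard : (topSet v m).card = m := by rw [ht]; exact card_ge v m h1 h2 hlt
  have e1 : ∃ i ∈ A, i ∉ topSet v m := by
    by_contra h
    push Not at h
    exact hne (Finset.eq_of_subset_of_card_le h (by omega)).symm
  have e2 : ∃ j ∈ topSet v m, j ∉ A := by
    by_contra h
    push Not at h
    exact hne (Finset.eq_of_subset_of_card_le h (by omega))
  obtain ⟨i, hi, hi'⟩ := e1
  obtain ⟨j, hj, hj'⟩ := e2
  refine ⟨i, hi, j, by simpa using hj', ?_⟩
  rw [ht] at hi' hj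
  simp only [Finset.mem_filter, Finset.mem_univ, true_and] at hi' hj
  have := (dichotomy v m h1 h2 i).resolve_left hi'
  linarith

lemma stopTime_spec {Ω : Type*} (Q : ℕ → Ω → Prop) (ω : Ω) (h : ∃ n, 1 ≤ n ∧ Q n ω) :
    Q (stopTime Q ω).toNat ω := by
  have hne : {n : ℕ∞ | ∃ m : ℕ, n = (m : ℕ∞) ∧ 1 ≤ m ∧ Q m ω}.Nonempty := by
    obtain ⟨n, hn⟩ := h
    exact ⟨n, n, rfl, hn⟩
  obtain ⟨n, hn, -, hQ⟩ := csInf_mem hne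
  unfold stopTime
  rw [hn]
  simpa using hQ

lemma pair_bound {Ω : Type*} [MeasurableSpace Ω] {K : ℕ}
    (F : ℕ → MeasurableSpace Ω) (hFle : ∀ n, F n ≤ ‹MeasurableSpace Ω›)
    (hFmono : Monotone F)
    (P : Finset (Fin K) → Measure Ω) [∀ A : Finset (Fin K), IsProbabilityMeasure (P A)]
    (lam : Fin K → ℕ → Ω → ℝ)
    (hadapt : ∀ (k : Fin K) (n : ℕ), Measurable[F n] fun ω => lam k n ω)
    (hLR : ∀ (A C : Finset (Fin K)) (n : ℕ) (Γ : Set Ω), MeasurableSet[F n] Γ →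
      (P A Γ).toReal = ∫ ω in Γ, Real.exp (llrAC lam A C n ω) ∂ P C)
    (A : Finset (Fin K)) (i j : Fin K) (hi : i ∈ A) (hj : j ∉ A) (c : ℝ) :
    P A {ω | ∃ n, c ≤ lam j n ω - lam i n ω} ≤ ENNReal.ofReal (Real.exp (-c)) := by
  set C : Finset (Fin K) := insert j (A.erase i) with hC
  have hij : i ≠ j := fun h => hj (h ▸ hi)
  have hAC : A \ C = {i} := by
    ext k
    simp only [hC, Finset.mem_sdiff, Finset.mem_insert, Finset.mem_erase, Finset.mem_singleton]
    constructor
    · rintro ⟨h1, h2⟩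
      by_contra h
      exact h2 (Or.inr ⟨h, h1⟩)
    · rintro rfl
      exact ⟨hi, by tauto⟩
  have hCA : C \ A = {j} := by
    ext k
    simp only [hC, Finset.mem_sdiff, Finset.mem_insert, Finset.mem_erase, Finset.mem_singleton]
    constructor
    · rintro ⟨h1, h2⟩
      tauto
    · rintro rfl
      exact ⟨Or.inl rfl, hj⟩
  let D : ℕ → Set Ω := fun n =>
    {ω | c ≤ lam j n ω - lam i n ω} ∩ ⋂ k ∈ Set.Iio n, {ω | lam j k ω - lam i k ω < c}
  have hD : ∀ n, MeasurableSet[F n] (D n) := by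
    intro n
    have hm : ∀ k ≤ n, Measurable[F n] fun ω => lam j k ω - lam i k ω := by
      intro k hk
      exact Measurable.sub ((hadapt j k).mono (hFmono hk) le_rfl)
        ((hadapt i k).mono (hFmono hk) le_rfl)
    apply @MeasurableSet.inter _ (F n)
    · exact hm n le_rfl measurableSet_Ici
    · refine @MeasurableSet.biInter _ _ (F n) _ _ (Set.to_countable _) ?_
      intro k hk
      exact hm k (le_of_lt hk) measurableSet_Iio
  have hDd : Pairwise (Function.onFun Disjoint D) := by
    have aux : ∀ a b, a < b → Disjoint (D a) (D b) := by
      intro a b hab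
      rw [Set.disjoint_left]
      rintro ω ⟨h1, -⟩ ⟨-, h2⟩
      have h3 := Set.mem_iInter₂.1 h2 a hab
      simp only [Set.mem_ofPred_eq] at h1 h3
      linarith
    intro a b hab
    rcases lt_or_gt_of_ne hab with h | h
    · exact aux a b h
    · exact (aux b a h).symm
  have hb : ∀ n, P A (D n) ≤ ENNReal.ofReal (Real.exp (-c)) * P C (D n) := by
    intro n
    have h1 := hLR A C n (D n) (hD n)
    have h2 : ‖∫ ω in D n, Real.exp (llrAC lam A C n ω) ∂ P C‖
        ≤ Real.exp (-c) * (P C).real (D n) := by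
      apply norm_setIntegral_le_of_norm_le_const (measure_lt_top _ _)
      rintro ω ⟨hω, -⟩
      rw [Real.norm_eq_abs, abs_of_pos (Real.exp_pos _), Real.exp_le_exp]
      simp only [llrAC, hAC, hCA, Finset.sum_singleton]
      simp only [Set.mem_ofPred_eq] at hω
      linarith
    rw [← h1, Real.norm_eq_abs, abs_of_nonneg ENNReal.toReal_nonneg] at h2
    rw [← ENNReal.ofReal_toReal (measure_ne_top (P A) (D n)),
      ← ENNReal.ofReal_toReal (measure_ne_top (P C) (D n)),
      ← ENNReal.ofReal_mul (Real.exp_pos _).le]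
    exact ENNReal.ofReal_le_ofReal h2
  have hsub : {ω | ∃ n, c ≤ lam j n ω - lam i n ω} ⊆ ⋃ n, D n := by
    intro ω hω
    have hω' : ∃ n, c ≤ lam j n ω - lam i n ω := hω
    refine Set.mem_iUnion.2 ⟨Nat.find hω', Nat.find_spec hω', ?_⟩
    refine Set.mem_iInter₂.2 fun k hk => ?_
    exact not_le.1 (Nat.find_min hω' hk)
  calc P A {ω | ∃ n, c ≤ lam j n ω - lam i n ω} ≤ P A (⋃ n, D n) := measure_mono hsub
    _ ≤ ∑' n, P A (D n) := measure_iUnion_le _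
    _ ≤ ∑' n, ENNReal.ofReal (Real.exp (-c)) * P C (D n) := ENNReal.tsum_le_tsum hb
    _ = ENNReal.ofReal (Real.exp (-c)) * P C (⋃ n, D n) := by
        rw [ENNReal.tsum_mul_left, measure_iUnion hDd fun n => hFle n _ (hD n)]
    _ ≤ ENNReal.ofReal (Real.exp (-c)) * 1 := by gcongr; exact prob_le_one
    _ = _ := mul_one _


/-- **Gap rule with the universal threshold `c = |log(α ∧ β)| + log(m(K-m))` belongs to
`Δ_{α,β}(P_m)`.**  For every `A` with `|A| = m`, `P_A(d_G ≠ A) ≤ α ∧ β`; consequently both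
familywise error probabilities are controlled at levels `α` and `β` on the class
`P_m = {A ⊆ [K] : |A| = m}`. -/
theorem gap_rule_in_Delta
    {Ω : Type*} [MeasurableSpace Ω] {K : ℕ}
    (F : ℕ → MeasurableSpace Ω) (hFle : ∀ n, F n ≤ ‹MeasurableSpace Ω›)
    (hFmono : Monotone F)
    (P : Finset (Fin K) → Measure Ω) [∀ A : Finset (Fin K), IsProbabilityMeasure (P A)]
    (lam : Fin K → ℕ → Ω → ℝ)
    (hadapt : ∀ (k : Fin K) (n : ℕ), Measurable[F n] fun ω => lam k n ω)
    (hLR : ∀ (A C : Finset (Fin K)) (n : ℕ) (Γ : Set Ω), MeasurableSet[F n] Γ →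
      (P A Γ).toReal = ∫ ω in Γ, Real.exp (llrAC lam A C n ω) ∂ P C)
    (hdiv1 : ∀ (A : Finset (Fin K)) (k : Fin K), k ∈ A →
      ∀ᵐ ω ∂ P A, Tendsto (fun n => lam k n ω) atTop atTop)
    (hdiv0 : ∀ (A : Finset (Fin K)) (k : Fin K), k ∉ A →
      ∀ᵐ ω ∂ P A, Tendsto (fun n => lam k n ω) atTop atBot)
    (m : ℕ) (hm1 : 1 ≤ m) (hmK : m ≤ K - 1)
    (α β : ℝ) (hα : α ∈ Set.Ioo (0:ℝ) 1) (hβ : β ∈ Set.Ioo (0:ℝ) 1)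
    (c : ℝ) (hcdef : c = |Real.log (min α β)| + Real.log ((m : ℝ) * ((K : ℝ) - m))) :
    (∀ A : Finset (Fin K), A.card = m →
      (P A {ω | gapDecision lam m c ω ≠ A}).toReal ≤ min α β) ∧
    InDelta P {B : Finset (Fin K) | B.card = m} α β (gapTime lam m c) (gapDecision lam m c) := by
  have h2 : m + 1 ≤ K := by omega
  have hmin0 : 0 < min α β := lt_min hα.1 hβ.1
  have hmin1 : min α β < 1 := lt_of_le_of_lt (min_le_left _ _) hα.2
  have hlog : Real.log (min α β) < 0 := Real.log_neg hmin0 hmin1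
  have hm1' : (1 : ℝ) ≤ m := by exact_mod_cast hm1
  have hKm : (1 : ℝ) ≤ (K : ℝ) - m := by
    have : ((m + 1 : ℕ) : ℝ) ≤ K := by exact_mod_cast h2
    push_cast at this
    linarith
  have hprod : (1 : ℝ) ≤ (m : ℝ) * ((K : ℝ) - m) := by nlinarith
  have hc0 : 0 < c := by
    rw [hcdef, abs_of_neg hlog]
    have := Real.log_nonneg hprod
    linarith
  have hexp : (m : ℝ) * ((K : ℝ) - m) * Real.exp (-c) = min α β := by
    rw [hcdef, abs_of_neg hlog, neg_add, neg_neg, Real.exp_add, Real.exp_log hmin0,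
      Real.exp_neg, Real.exp_log (by linarith)]
    field_simp
  have main : ∀ A : Finset (Fin K), A.card = m →
      (P A {ω | gapDecision lam m c ω ≠ A}).toReal ≤ min α β := by
    intro A hA
    have hAc : (Aᶜ).card = K - m := by rw [Finset.card_compl, Fintype.card_fin, hA]
    have hfin : ∀ᵐ ω ∂ P A, ∃ n, 1 ≤ n ∧
        c ≤ orderStat (fun k => lam k n ω) m - orderStat (fun k => lam k n ω) (m + 1) := by
      have g1 : ∀ᵐ ω ∂ P A, ∀ k, k ∈ A → Tendsto (fun n => lam k n ω) atTop atTop :=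
        ae_all_iff.2 fun k => by
          by_cases hk : k ∈ A
          · filter_upwards [hdiv1 A k hk] with ω h _ using h
          · exact Eventually.of_forall fun ω h => absurd h hk
      have g0 : ∀ᵐ ω ∂ P A, ∀ k, k ∉ A → Tendsto (fun n => lam k n ω) atTop atBot :=
        ae_all_iff.2 fun k => by
          by_cases hk : k ∈ A
          · exact Eventually.of_forall fun ω h => absurd hk h
          · filter_upwards [hdiv0 A k hk] with ω h _ using h
      filter_upwards [g1, g0] with ω k1 k0
      have e1 : ∀ᶠ n in atTop, ∀ k, k ∈ A → c ≤ lam k n ω :=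
        eventually_all.2 fun k => by
          by_cases hk : k ∈ A
          · filter_upwards [(k1 k hk).eventually_ge_atTop c] with n h _ using h
          · exact Eventually.of_forall fun ω h => absurd h hk
      have e0 : ∀ᶠ n in atTop, ∀ k, k ∉ A → lam k n ω ≤ 0 :=
        eventually_all.2 fun k => by
          by_cases hk : k ∈ A
          · exact Eventually.of_forall fun ω h => absurd hk h
          · filter_upwards [(k0 k hk).eventually_le_atBot 0] with n h _ using h
      obtain ⟨n, ⟨hn1, hn0⟩, hn⟩ := ((e1.and e0).and (eventually_ge_atTop 1)).exists
      refine ⟨n, hn, ?_⟩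
      have a1 : c ≤ orderStat (fun k => lam k n ω) m := by
        apply le_orderStat _ _ hm1 (by omega)
        rw [← hA]
        apply Finset.card_le_card
        intro k hk
        simpa using hn1 k hk
      have a0 : orderStat (fun k => lam k n ω) (m + 1) ≤ 0 := by
        apply orderStat_le _ _ (by omega) h2
        have : K - (m + 1) + 1 = (Aᶜ).card := by omega
        rw [this]
        apply Finset.card_le_card
        intro k hk
        simpa using hn0 k (by simpa using hk)
      linarith
    have hle : P A {ω | gapDecision lam m c ω ≠ A} ≤
        P A (⋃ p ∈ A ×ˢ Aᶜ, {ω | ∃ n, c ≤ lam p.2 n ω - lam p.1 n ω}) := by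
      apply measure_mono_ae
      filter_upwards [hfin] with ω hω hne
      have hs := stopTime_spec (fun n ω =>
        c ≤ orderStat (fun k => lam k n ω) m - orderStat (fun k => lam k n ω) (m + 1)) ω hω
      obtain ⟨i, hi, j, hj, hc⟩ := exists_pair
        (fun k => lam k (gapTime lam m c ω).toNat ω) m hm1 h2 c hc0 hs A hA hne
      exact Set.mem_iUnion₂.2 ⟨(i, j), Finset.mem_product.2 ⟨hi, hj⟩, _, hc⟩
    have hub : P A {ω | gapDecision lam m c ω ≠ A} ≤ ENNReal.ofReal (min α β) := by
      calc _ ≤ _ := hle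
        _ ≤ ∑ p ∈ A ×ˢ Aᶜ, P A {ω | ∃ n, c ≤ lam p.2 n ω - lam p.1 n ω} :=
            measure_biUnion_finset_le _ _
        _ ≤ ∑ p ∈ A ×ˢ Aᶜ, ENNReal.ofReal (Real.exp (-c)) := by
            apply Finset.sum_le_sum
            intro p hp
            have hp' := Finset.mem_product.1 hp
            exact pair_bound F hFle hFmono P lam hadapt hLR A p.1 p.2 hp'.1
              (by simpa using hp'.2) c
        _ = ENNReal.ofReal (min α β) := by
            rw [← ENNReal.ofReal_sum_of_nonneg fun _ _ => (Real.exp_pos _).le,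
              Finset.sum_const, Finset.card_product, hA, hAc, nsmul_eq_mul, ← hexp]
            push_cast [Nat.cast_sub (show m ≤ K by omega)]
            rfl
    exact ENNReal.toReal_le_of_le_ofReal hmin0.le hub
  refine ⟨main, ?_⟩
  intro A hA
  have hmA := main A hA
  constructor
  · refine le_trans (le_trans ?_ hmA) (min_le_left _ _)
    refine ENNReal.toReal_mono (measure_ne_top _ _) (measure_mono ?_)
    intro ω h1 h2
    exact h1 (by rw [h2])
  · refine le_trans (le_trans ?_ hmA) (min_le_right _ _)
    refine ENNReal.toReal_mono (measure_ne_top _ _) (measure_mono ?_)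
    intro ω h1 h2
    exact h1 (by rw [h2])

end SeqMT
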